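/- Let g ∈ C²(ℝ) and define f(x,y,z) = x² + y² − g(z) on the Heisenberg group ℍ. Then for every p = (x,y,z) ∈ ℍ: if (x,y) ≠ (0,0) then ∇_H f(p) ≠ 0 and L[f](p) = 2 − 4(x²+y²)g''(z)/(16 + g'(z)²), while if (x,y) = (0,0) then ∇_H f(p) = 0, (∇²_H f)*(p) = 2I and L[f](p) = 2. -/

import Mathlib

open Filter Topology

noncomputable section

abbrev Heis := ℝ × ℝ × ℝ

def hMul (p q : Heis) : Heis :=
  (p.1 + q.1, p.2.1 + q.2.1, p.2.2 + q.2.2 + (p.1 * q.2.1 - q.1 * p.2.1) / 2)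

def horiz : Set Heis := {h : Heis | h.2.2 = 0}

def hPlane (p : Heis) : Set Heis := {q : Heis | ∃ h ∈ horiz, q = hMul p h}

def hSeg (p q : Heis) : Set Heis :=
  {w : Heis | ∃ l : ℝ, 0 ≤ l ∧ l ≤ 1 ∧ w = l • p + (1 - l) • q}

def HConvex (E : Set Heis) : Prop :=
  ∀ p ∈ E, ∀ q ∈ E, q ∈ hPlane p → hSeg p q ⊆ E

def HQuasiconvexOn (f : Heis → ℝ) (Ω : Set Heis) : Prop :=
  ∀ p ∈ Ω, ∀ q ∈ Ω, q ∈ hPlane p → ∀ w ∈ hSeg p q, f w ≤ max (f p) (f q)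

def X1 (f : Heis → ℝ) (p : Heis) : ℝ :=
  fderiv ℝ f p (1, 0, 0) - p.2.1 / 2 * fderiv ℝ f p (0, 0, 1)

def X2 (f : Heis → ℝ) (p : Heis) : ℝ :=
  fderiv ℝ f p (0, 1, 0) + p.1 / 2 * fderiv ℝ f p (0, 0, 1)

def gradH (f : Heis → ℝ) (p : Heis) : ℝ × ℝ := (X1 f p, X2 f p)

def hessH (f : Heis → ℝ) (p : Heis) : ℝ × ℝ × ℝ :=
  (X1 (X1 f) p, (X1 (X2 f) p + X2 (X1 f) p) / 2, X2 (X2 f) p)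

def L0H (ξ : ℝ × ℝ) (A : ℝ × ℝ × ℝ) : ℝ :=
  sInf {m : ℝ | ∃ η : ℝ × ℝ, η.1 ^ 2 + η.2 ^ 2 = 1 ∧ ξ.1 * η.1 + ξ.2 * η.2 = 0 ∧
    m = A.1 * η.1 ^ 2 + 2 * A.2.1 * η.1 * η.2 + A.2.2 * η.2 ^ 2}

def Lop (f : Heis → ℝ) (p : Heis) : ℝ := L0H (gradH f p) (hessH f p)

def LbarOp (f : Heis → ℝ) (p : Heis) : ℝ := limsup (Lop f) (𝓝 p)

def LstarOp (f : Heis → ℝ) (p : Heis) : ℝ :=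
  limsup (fun q : (ℝ × ℝ) × ℝ × ℝ × ℝ => L0H q.1 q.2) (𝓝 (gradH f p, hessH f p))

def StrictLocalMaxOnSet (g : Heis → ℝ) (Ω : Set Heis) (p : Heis) : Prop :=
  ∃ U ∈ 𝓝 p, ∀ q ∈ U ∩ Ω, q ≠ p → g q < g p

def UniformlyHQuasiconvexOn (f : Heis → ℝ) (Ω : Set Heis) (r₀ lam : ℝ) : Prop :=
  ∀ r : ℝ, 0 < r → r < r₀ → ∀ p ∈ Ω, ∀ v ∈ horiz, v.1 ^ 2 + v.2.1 ^ 2 = 1 →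
    hMul p (r • v) ∈ Ω → hMul p (-(r • v)) ∈ Ω →
    f p ≤ max (f (hMul p (r • v))) (f (hMul p (-(r • v)))) - lam * r ^ 2

def gaugeK (p : Heis) : ℝ := ((p.1 ^ 2 + p.2.1 ^ 2) ^ 2 + 16 * p.2.2 ^ 2) ^ ((1 : ℝ) / 4)


theorem X1_eq_of_hasFDerivAt {F : Heis → ℝ} {L : Heis →L[ℝ] ℝ} {p : Heis}
    (h : HasFDerivAt F L p) : X1 F p = L (1, 0, 0) - p.2.1 / 2 * L (0, 0, 1) := by
  rw [X1, h.fderiv]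

theorem X2_eq_of_hasFDerivAt {F : Heis → ℝ} {L : Heis →L[ℝ] ℝ} {p : Heis}
    (h : HasFDerivAt F L p) : X2 F p = L (0, 1, 0) + p.1 / 2 * L (0, 0, 1) := by
  rw [X2, h.fderiv]

theorem hasFDerivAt_coord_x (p : Heis) :
    HasFDerivAt (fun q : Heis => q.1) (ContinuousLinearMap.fst ℝ ℝ (ℝ × ℝ)) p :=
  hasFDerivAt_fst

theorem hasFDerivAt_coord_y (p : Heis) :
    HasFDerivAt (fun q : Heis => q.2.1)
      ((ContinuousLinearMap.fst ℝ ℝ ℝ).comp (ContinuousLinearMap.snd ℝ ℝ (ℝ × ℝ))) p :=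
  ((ContinuousLinearMap.fst ℝ ℝ ℝ).comp (ContinuousLinearMap.snd ℝ ℝ (ℝ × ℝ))).hasFDerivAt

theorem hasFDerivAt_coord_z (p : Heis) :
    HasFDerivAt (fun q : Heis => q.2.2)
      ((ContinuousLinearMap.snd ℝ ℝ ℝ).comp (ContinuousLinearMap.snd ℝ ℝ (ℝ × ℝ))) p :=
  ((ContinuousLinearMap.snd ℝ ℝ ℝ).comp (ContinuousLinearMap.snd ℝ ℝ (ℝ × ℝ))).hasFDerivAt

section Derivatives

variable {g : ℝ → ℝ}

theorem exists_hasFDerivAt_radial_sub (hg : Differentiable ℝ g) (p : Heis) :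
    ∃ L : Heis →L[ℝ] ℝ, HasFDerivAt (fun q : Heis => q.1 ^ 2 + q.2.1 ^ 2 - g q.2.2) L p ∧
      ∀ v, L v = 2 * p.1 * v.1 + 2 * p.2.1 * v.2.1 - deriv g p.2.2 * v.2.2 :=
  ⟨_, (((hasFDerivAt_coord_x p).pow 2).add ((hasFDerivAt_coord_y p).pow 2)).sub
    ((hg p.2.2).hasDerivAt.comp_hasFDerivAt p (hasFDerivAt_coord_z p)), fun v => by simp⟩

theorem X1_radial_sub (hg : Differentiable ℝ g) :
    X1 (fun q : Heis => q.1 ^ 2 + q.2.1 ^ 2 - g q.2.2) =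
      fun p => 2 * p.1 + p.2.1 * (2⁻¹ * deriv g p.2.2) := by
  funext p
  obtain ⟨L, hL, hv⟩ := exists_hasFDerivAt_radial_sub hg p
  rw [X1_eq_of_hasFDerivAt hL, hv, hv]
  dsimp only
  ring

theorem X2_radial_sub (hg : Differentiable ℝ g) :
    X2 (fun q : Heis => q.1 ^ 2 + q.2.1 ^ 2 - g q.2.2) =
      fun p => 2 * p.2.1 - p.1 * (2⁻¹ * deriv g p.2.2) := by
  funext p
  obtain ⟨L, hL, hv⟩ := exists_hasFDerivAt_radial_sub hg p
  rw [X2_eq_of_hasFDerivAt hL, hv, hv]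
  dsimp only
  ring

theorem hessH_radial_sub (hg : Differentiable ℝ g) (hg' : Differentiable ℝ (deriv g))
    (p : Heis) :
    hessH (fun q : Heis => q.1 ^ 2 + q.2.1 ^ 2 - g q.2.2) p =
      (2 - p.2.1 ^ 2 * deriv (deriv g) p.2.2 / 4,
        p.1 * p.2.1 * deriv (deriv g) p.2.2 / 4,
        2 - p.1 ^ 2 * deriv (deriv g) p.2.2 / 4) := by
  have hz := ((hg' p.2.2).hasDerivAt.comp_hasFDerivAt p (hasFDerivAt_coord_z p)).const_mul
    (2⁻¹ : ℝ)
  have h1 := ((hasFDerivAt_coord_x p).const_mul (2 : ℝ)).add ((hasFDerivAt_coord_y p).mul hz)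
  have h2 := ((hasFDerivAt_coord_y p).const_mul (2 : ℝ)).sub ((hasFDerivAt_coord_x p).mul hz)
  have e11 := X1_eq_of_hasFDerivAt h1
  have e21 := X2_eq_of_hasFDerivAt h1
  have e12 := X1_eq_of_hasFDerivAt h2
  have e22 := X2_eq_of_hasFDerivAt h2
  rw [hessH, X1_radial_sub hg, X2_radial_sub hg]
  refine Prod.ext ?_ (Prod.ext ?_ ?_)
  · refine e11.trans ?_
    simp
    ring
  · refine (congrArg₂ (fun a b : ℝ => (a + b) / 2) e12 e21).trans ?_
    simp
    ring
  · refine e22.trans ?_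
    simp
    ring

end Derivatives

theorem L0H_of_ne_zero {ξ : ℝ × ℝ} (hξ : ξ ≠ 0) (A : ℝ × ℝ × ℝ) :
    L0H ξ A = (A.1 * ξ.2 ^ 2 - 2 * A.2.1 * ξ.1 * ξ.2 + A.2.2 * ξ.1 ^ 2) /
      (ξ.1 ^ 2 + ξ.2 ^ 2) := by
  have hpos : 0 < ξ.1 ^ 2 + ξ.2 ^ 2 := by
    by_contra! h
    exact hξ (Prod.ext (by simp; nlinarith [sq_nonneg ξ.1, sq_nonneg ξ.2])
      (by simp; nlinarith [sq_nonneg ξ.1, sq_nonneg ξ.2]))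
  rw [L0H]
  refine Eq.trans (congrArg sInf ?_) (csInf_singleton _)
  ext m
  simp only [Set.mem_ofPred_eq, Set.mem_singleton_iff]
  constructor
  · rintro ⟨⟨s, t⟩, hn, ho, rfl⟩
    simp only at hn ho ⊢
    have hs : (ξ.1 ^ 2 + ξ.2 ^ 2) * s ^ 2 = ξ.2 ^ 2 := by
      linear_combination ξ.2 ^ 2 * hn + (ξ.1 * s - ξ.2 * t) * ho
    have ht : (ξ.1 ^ 2 + ξ.2 ^ 2) * t ^ 2 = ξ.1 ^ 2 := by
      linear_combination ξ.1 ^ 2 * hn - (ξ.1 * s - ξ.2 * t) * ho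
    have hst : (ξ.1 ^ 2 + ξ.2 ^ 2) * (s * t) = -(ξ.1 * ξ.2) := by
      linear_combination (ξ.1 * t + ξ.2 * s) * ho - ξ.1 * ξ.2 * hn
    rw [eq_div_iff hpos.ne']
    linear_combination A.1 * hs + 2 * A.2.1 * hst + A.2.2 * ht
  · rintro rfl
    set r := √(ξ.1 ^ 2 + ξ.2 ^ 2) with hr
    have hr2 : r ^ 2 = ξ.1 ^ 2 + ξ.2 ^ 2 := Real.sq_sqrt hpos.le
    have hr0 : r ≠ 0 := (Real.sqrt_pos.2 hpos).ne'
    refine ⟨(-ξ.2 / r, ξ.1 / r), ?_, ?_, ?_⟩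
    · field_simp
      linarith
    · ring
    · rw [← hr2]
      field_simp
      ring

theorem L0H_zero_scalar (c : ℝ) : L0H 0 (c, 0, c) = c := by
  rw [L0H]
  refine Eq.trans (congrArg sInf ?_) (csInf_singleton c)
  ext m
  simp only [Set.mem_ofPred_eq, Set.mem_singleton_iff]
  constructor
  · rintro ⟨η, hn, -, rfl⟩
    linear_combination c * hn
  · rintro rfl
    exact ⟨(1, 0), by norm_num, by simp, by simp⟩

theorem statement5 (g : ℝ → ℝ) (hg : ContDiff ℝ 2 g)
    (f : Heis → ℝ) (hf : f = fun p => p.1 ^ 2 + p.2.1 ^ 2 - g p.2.2) :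
    ∀ p : Heis,
      (((p.1, p.2.1) : ℝ × ℝ) ≠ (0, 0) →
        gradH f p ≠ 0 ∧
        Lop f p = 2 - 4 * (p.1 ^ 2 + p.2.1 ^ 2) * deriv (deriv g) p.2.2 /
          (16 + (deriv g p.2.2) ^ 2)) ∧
      (((p.1, p.2.1) : ℝ × ℝ) = (0, 0) →
        gradH f p = 0 ∧ hessH f p = (2, 0, 2) ∧ Lop f p = 2) := by
  subst hf
  have hd : Differentiable ℝ g := hg.differentiable (by norm_num)
  have hd' : Differentiable ℝ (deriv g) :=
    (hg.iterate_deriv' 1 1).differentiable (by norm_num)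
  have hgrad (p : Heis) : gradH (fun p : Heis => p.1 ^ 2 + p.2.1 ^ 2 - g p.2.2) p =
      (2 * p.1 + p.2.1 * (2⁻¹ * deriv g p.2.2), 2 * p.2.1 - p.1 * (2⁻¹ * deriv g p.2.2)) := by
    rw [gradH, X1_radial_sub hd, X2_radial_sub hd]
  rintro ⟨x, y, z⟩
  rw [Lop, hgrad, hessH_radial_sub hd hd']
  dsimp only
  constructor
  · intro hxy
    have hr : 0 < x ^ 2 + y ^ 2 := by
      by_contra! h
      exact hxy (Prod.ext (by simp; nlinarith [sq_nonneg x, sq_nonneg y])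
        (by simp; nlinarith [sq_nonneg x, sq_nonneg y]))
    set a := deriv g z
    have hnorm : (2 * x + y * (2⁻¹ * a)) ^ 2 + (2 * y - x * (2⁻¹ * a)) ^ 2 =
        (x ^ 2 + y ^ 2) * (16 + a ^ 2) / 4 := by ring
    have ha : 0 < 16 + a ^ 2 := by positivity
    have hne : ((2 * x + y * (2⁻¹ * a), 2 * y - x * (2⁻¹ * a)) : ℝ × ℝ) ≠ 0 := by
      intro h
      obtain ⟨h1, h2⟩ := Prod.mk_eq_zero.1 h
      rw [h1, h2] at hnorm
      have : 0 < (x ^ 2 + y ^ 2) * (16 + a ^ 2) / 4 := by positivity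
      linarith
    refine ⟨hne, ?_⟩
    rw [L0H_of_ne_zero hne]
    dsimp only
    rw [hnorm]
    field_simp
    ring
  · intro hxy
    obtain ⟨rfl, rfl⟩ := Prod.mk.inj hxy
    have h0 : (0, 0) = (0 : ℝ × ℝ) := rfl
    simp [h0, L0H_zero_scalar]
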